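/- arXiv:math/0107008 — 2 statements merged into one kernel-verified Lean document; each statement's English description precedes it below -/
import Mathlib

section
/- Let X be a G-tree. An element γ of G is hyperbolic (i.e., fixes no vertex of X) under any one of the following conditions: (1) the distance d(x, γx) is odd for some vertex x of X; (2) for some vertex x not fixed by γ, the edges of the path [x, γx] map injectively to the edges of the quotient graph G\X; (3) for some edge e not fixed by γ, the edges e and γe are coherently oriented (i.e., the segment from ∂₀e to ∂₀(γe) contains exactly one of e, γe). -/
universe u

/-- A `G`-tree: a simplicial tree together with an action of `G` by graph
automorphisms without inversions. -/
structure GTree (G : Type u) [Group G] : Type (u + 1) where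
  V : Type u
  graph : SimpleGraph V
  isTree : graph.IsTree
  smul : G → V → V
  smul_one : ∀ x, smul 1 x = x
  smul_mul : ∀ γ δ x, smul (γ * δ) x = smul γ (smul δ x)
  smul_adj : ∀ (γ : G) ⦃x y : V⦄, graph.Adj x y → graph.Adj (smul γ x) (smul γ y)
  no_inversions : ∀ (γ : G) (x y : V), graph.Adj x y → ¬(smul γ x = y ∧ smul γ y = x)

namespace GTree

variable {G : Type u} [Group G]

/-- Oriented edges of a `G`-tree. -/
def Edge (X : GTree G) : Type u := { p : X.V × X.V // X.graph.Adj p.1 p.2 }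

/-- Initial vertex `∂₀ e` of an oriented edge. -/
def d0 {X : GTree G} (e : X.Edge) : X.V := e.1.1

/-- Terminal vertex `∂₁ e` of an oriented edge. -/
def d1 {X : GTree G} (e : X.Edge) : X.V := e.1.2

/-- The underlying geometric (unoriented) edge. -/
def esym {X : GTree G} (e : X.Edge) : Sym2 X.V := s(e.1.1, e.1.2)

/-- Action of `G` on oriented edges. -/
def edgeSmul {X : GTree G} (γ : G) (e : X.Edge) : X.Edge :=
  ⟨(X.smul γ e.1.1, X.smul γ e.1.2), X.smul_adj γ e.2⟩

/-- Vertex stabilizer `G_x`. -/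
def stab (X : GTree G) (x : X.V) : Subgroup G where
  carrier := { γ | X.smul γ x = x }
  one_mem' := X.smul_one x
  mul_mem' := by
    intro a b ha hb
    simp only [Set.mem_setOf_eq] at *
    rw [X.smul_mul, hb, ha]
  inv_mem' := by
    intro a ha
    simp only [Set.mem_setOf_eq] at *
    conv_lhs => rw [← ha]
    rw [← X.smul_mul, inv_mul_cancel, X.smul_one]

/-- Edge stabilizer `G_e`: the elements fixing both endpoints (since the action
is without inversions, these are exactly the elements fixing the edge). -/
def edgeStab (X : GTree G) (e : X.Edge) : Subgroup G :=
  X.stab (d0 e) ⊓ X.stab (d1 e)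

/-- An element of `G` is elliptic if it fixes a vertex. -/
def Elliptic (X : GTree G) (γ : G) : Prop := ∃ x, X.smul γ x = x

/-- A subgroup of `G` is elliptic if it fixes a vertex. -/
def FixesVertex (X : GTree G) (H : Subgroup G) : Prop := ∃ x, ∀ γ ∈ H, X.smul γ x = x

/-- Two `G`-trees have the same elliptic subgroups. -/
def SameEllipticSubgroups (X Y : GTree G) : Prop :=
  ∀ H : Subgroup G, X.FixesVertex H ↔ Y.FixesVertex H

/-- The length function `ℓ_X(γ)`: the minimal vertex displacement. -/
noncomputable def transLen (X : GTree G) (γ : G) : ℕ :=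
  sInf (Set.range fun x => X.graph.dist x (X.smul γ x))

/-- Cocompact: the quotient graph `G\X` is finite, i.e. there are finitely
many orbits of vertices and of edges. -/
def Cocompact (X : GTree G) : Prop :=
  Finite (Quot fun x y : X.V => ∃ γ, X.smul γ x = y) ∧
    Finite (Quot fun e f : X.Edge => ∃ γ, edgeSmul γ e = f)

/-- Reduced: whenever `G_e = G_{∂₀ e}`, the endpoints of `e` are in the same
`G`-orbit. -/
def Reduced (X : GTree G) : Prop :=
  ∀ e : X.Edge, X.edgeStab e = X.stab (d0 e) → ∃ γ, X.smul γ (d0 e) = d1 e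

/-- A nonempty `G`-invariant subtree (a nonempty invariant set of vertices that
is connected in the induced graph). -/
def IsInvariantSubtree (X : GTree G) (S : Set X.V) : Prop :=
  S.Nonempty ∧ (∀ γ, ∀ x ∈ S, X.smul γ x ∈ S) ∧
    ∀ x ∈ S, ∀ y ∈ S, ∃ p : X.graph.Walk x y, ∀ v ∈ p.support, v ∈ S

/-- Minimal: there is no proper nonempty invariant subtree. -/
def Minimal (X : GTree G) : Prop :=
  ∀ S : Set X.V, X.IsInvariantSubtree S → S = Set.univ

/-- Strongly slide-free: minimal, and for all edges `e`, `f` with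
`∂₀ e = ∂₀ f`, the inclusion `G_e ⊆ G_f` implies `f ∈ G e`. -/
def StronglySlideFree (X : GTree G) : Prop :=
  X.Minimal ∧ ∀ e f : X.Edge, d0 e = d0 f → X.edgeStab e ≤ X.edgeStab f →
    ∃ γ, edgeSmul γ e = f

/-- Proper: `G_e ⊊ G_{∂₀ e}` for every edge `e`. -/
def Proper (X : GTree G) : Prop := ∀ e : X.Edge, X.edgeStab e < X.stab (d0 e)

/-- Locally finite: every vertex has finite valence. -/
def LocallyFinite (X : GTree G) : Prop := ∀ x : X.V, (X.graph.neighborSet x).Finite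

/-- `φ` is an isomorphism of `G`-trees: an equivariant graph isomorphism. -/
def IsGIso (X Y : GTree G) (φ : X.V → Y.V) : Prop :=
  Function.Bijective φ ∧ (∀ x y, X.graph.Adj x y ↔ Y.graph.Adj (φ x) (φ y)) ∧
    ∀ γ x, φ (X.smul γ x) = Y.smul γ (φ x)

/-- `φ : X → Y` is the collapse move performed at (the orbit of) the edge `e`:
`G_e = G_{∂₀ e}`, the endpoints of `e` lie in different `G`-orbits, and `Y` is
the equivariant quotient of `X` identifying `∂₀(γ e)` with `∂₁(γ e)` for all
`γ ∈ G`. -/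
def IsCollapse (X Y : GTree G) (φ : X.V → Y.V) (e : X.Edge) : Prop :=
  X.edgeStab e = X.stab (d0 e) ∧
  (∀ γ : G, X.smul γ (d0 e) ≠ d1 e) ∧
  Function.Surjective φ ∧
  (∀ γ x, φ (X.smul γ x) = Y.smul γ (φ x)) ∧
  (∀ u v : X.V, φ u = φ v ↔
    Relation.EqvGen (fun a b => ∃ γ : G, a = X.smul γ (d0 e) ∧ b = X.smul γ (d1 e)) u v) ∧
  (∀ a b : Y.V, a ≠ b → (Y.graph.Adj a b ↔ ∃ u v, X.graph.Adj u v ∧ φ u = a ∧ φ v = b))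

/-- `Y` is obtained from `X` by a collapse move. -/
def Collapse (X Y : GTree G) : Prop := ∃ (φ : X.V → Y.V) (e : X.Edge), IsCollapse X Y φ e

/-- Elementary deformation: a finite composition of collapse moves and their
inverses (expansion moves). -/
def ElemDeformation : GTree G → GTree G → Prop := Relation.EqvGen Collapse

end GTree

namespace SimpleGraph.Walk

variable {V : Type*} {H : SimpleGraph V} {u v w : V}

lemma IsPath.append {p : H.Walk u v} {q : H.Walk v w} (hp : p.IsPath) (hq : q.IsPath)
    (h : ∀ z ∈ p.support, z ∈ q.support → z = v) : (p.append q).IsPath := by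
  have hq' := hq.support_nodup
  rw [← q.cons_tail_support, List.nodup_cons] at hq'
  rw [isPath_def, support_append, List.nodup_append']
  refine ⟨hp.support_nodup, hq'.2, fun z hzp hzq => ?_⟩
  exact hq'.1 (h z hzp (List.mem_of_mem_tail hzq) ▸ hzq)

/-- On a path that is a concatenation, an edge at the initial vertex lies in the first piece. -/
lemma IsPath.mem_edges_left_of_append {p : H.Walk u v} {q : H.Walk v w}
    (h : (p.append q).IsPath) (huv : u ≠ v) {x : V} (hx : s(u, x) ∈ (p.append q).edges) :
    s(u, x) ∈ p.edges := by
  rw [edges_append, List.mem_append] at hx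
  refine hx.resolve_right fun hq => ?_
  exact h.ne_of_mem_support_of_append huv p.start_mem_support
    (q.fst_mem_support_of_mem_edges hq) rfl

end SimpleGraph.Walk

namespace GTree

variable {G : Type u} [Group G] (X : GTree G)

lemma smul_injective (γ : G) : Function.Injective (X.smul γ) := fun x y h => by
  rw [← X.smul_one x, ← X.smul_one y, ← inv_mul_cancel γ, X.smul_mul, X.smul_mul, h]

/-- The graph endomorphism given by the action of a group element. -/
def smulHom (γ : G) : X.graph →g X.graph := ⟨X.smul γ, fun h => X.smul_adj γ h⟩

lemma isPath_unique {u v : X.V} {p q : X.graph.Walk u v} (hp : p.IsPath) (hq : q.IsPath) : p = q :=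
  (X.isTree.existsUnique_path u v).unique hp hq

/-- The translate of a walk by a group element. -/
def smulWalk (γ : G) {u v : X.V} (p : X.graph.Walk u v) :
    X.graph.Walk (X.smul γ u) (X.smul γ v) := p.map (X.smulHom γ)

variable {X}

lemma length_smulWalk (γ : G) {u v : X.V} (p : X.graph.Walk u v) :
    (X.smulWalk γ p).length = p.length := p.length_map (X.smulHom γ)

lemma edges_smulWalk (γ : G) {u v : X.V} (p : X.graph.Walk u v) :
    (X.smulWalk γ p).edges = p.edges.map (Sym2.map (X.smul γ)) := p.edges_map (X.smulHom γ)

lemma getVert_smulWalk (γ : G) {u v : X.V} (p : X.graph.Walk u v) (i : ℕ) :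
    (X.smulWalk γ p).getVert i = X.smul γ (p.getVert i) := p.getVert_map (X.smulHom γ) i

lemma isPath_smulWalk (γ : G) {u v : X.V} {p : X.graph.Walk u v} (hp : p.IsPath) :
    (X.smulWalk γ p).IsPath :=
  SimpleGraph.Walk.IsPath.map (f := X.smulHom γ) (X.smul_injective γ) hp

/-- If `γ` is elliptic, the path from `u` to `γ u` goes to a fixed vertex and comes back along
the `γ`-translate of its first half. -/
lemma Elliptic.exists_isPath_append {γ : G} (h : X.Elliptic γ) (u : X.V) :
    ∃ (m : X.V) (q : X.graph.Walk u m) (r : X.graph.Walk (X.smul γ u) m),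
      X.smul γ m = m ∧ (q.append r.reverse).IsPath ∧ r.length = q.length ∧
        r.edges = q.edges.map (Sym2.map (X.smul γ)) := by
  obtain ⟨m, hm, hmin⟩ := exists_minimalFor_of_wellFoundedLT
    (fun x => X.smul γ x = x) (fun x => X.graph.dist u x) h
  obtain ⟨q, hq, hlen⟩ := X.isTree.connected.exists_path_of_dist u m
  obtain ⟨r, hr, hrlen, hredges, hrvert⟩ : ∃ r : X.graph.Walk (X.smul γ u) m, r.IsPath ∧
      r.length = q.length ∧ r.edges = q.edges.map (Sym2.map (X.smul γ)) ∧
      ∀ i, r.getVert i = X.smul γ (q.getVert i) :=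
    ⟨(X.smulWalk γ q).copy rfl hm,
      by rw [SimpleGraph.Walk.isPath_copy]; exact isPath_smulWalk γ hq,
      by rw [SimpleGraph.Walk.length_copy, length_smulWalk],
      by rw [SimpleGraph.Walk.edges_copy, edges_smulWalk],
      fun i => by rw [SimpleGraph.Walk.getVert_copy, getVert_smulWalk]⟩
  refine ⟨m, q, r, hm, hq.append hr.reverse fun z hz hz' => ?_, hrlen, hredges⟩
  rw [SimpleGraph.Walk.support_reverse, List.mem_reverse] at hz'
  obtain ⟨i, rfl, hi⟩ := SimpleGraph.Walk.mem_support_iff_exists_getVert.mp hz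
  obtain ⟨j, hij, hj⟩ := SimpleGraph.Walk.mem_support_iff_exists_getVert.mp hz'
  have hdrop := congrArg SimpleGraph.Walk.length <| X.isPath_unique (hq.drop i)
    (q := (r.drop j).copy hij rfl) (by rw [SimpleGraph.Walk.isPath_copy]; exact hr.drop j)
  simp only [SimpleGraph.Walk.length_copy, SimpleGraph.Walk.drop_length] at hdrop
  obtain rfl : i = j := by omega
  have hle : X.graph.dist u (q.getVert i) ≤ i :=
    (SimpleGraph.dist_le (q.take i)).trans (by simp [SimpleGraph.Walk.take_length])
  have hmi : X.graph.dist u m ≤ X.graph.dist u (q.getVert i) :=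
    hmin ((hrvert i).symm.trans hij) (hle.trans (hi.trans hlen.le))
  rw [show i = q.length by omega, SimpleGraph.Walk.getVert_length]

end GTree

open GTree in
/-- Lemma 2.6 (hyperbolicity criteria): an element `γ` of `G` is hyperbolic
(fixes no vertex of `X`) under any of the conditions:
(1) `d(x, γ x)` is odd for some vertex `x`;
(2) for some vertex `x` not fixed by `γ`, the edges of the path `[x, γ x]`
    map injectively to the edges of the quotient graph `G\X`;
(3) for some edge `e` not fixed by `γ`, the edges `e` and `γ e` are coherently
    oriented, i.e. the segment `[∂₀ e, ∂₀ (γ e)]` contains exactly one of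
    `e`, `γ e`. -/
theorem hyperbolicity_criteria {G : Type u} [Group G] (X : GTree G) (γ : G)
    (h :
      (∃ x : X.V, Odd (X.graph.dist x (X.smul γ x))) ∨
      (∃ x : X.V, X.smul γ x ≠ x ∧
        ∃ p : X.graph.Walk x (X.smul γ x), p.IsPath ∧
          p.edges.Pairwise fun a b => ∀ δ : G, Sym2.map (X.smul δ) a ≠ b) ∨
      (∃ e : X.Edge, edgeSmul γ e ≠ e ∧
        ∃ p : X.graph.Walk (d0 e) (d0 (edgeSmul γ e)), p.IsPath ∧
          Xor' (esym e ∈ p.edges) (esym (edgeSmul γ e) ∈ p.edges))) :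
    ¬ X.Elliptic γ := by
  intro hγ
  rcases h with ⟨x, hx⟩ | ⟨x, hx, p, hp, hpw⟩ | ⟨e, -, p, hp, hxor⟩
  · obtain ⟨m, q, r, hm, hqr, hlen, -⟩ := hγ.exists_isPath_append x
    obtain ⟨p, hp, hpd⟩ := X.isTree.connected.exists_path_of_dist x (X.smul γ x)
    rw [← hpd, X.isPath_unique hp hqr, SimpleGraph.Walk.length_append,
      SimpleGraph.Walk.length_reverse, hlen] at hx
    exact Nat.not_odd_iff_even.mpr ⟨_, rfl⟩ hx
  · obtain ⟨m, q, r, hm, hqr, -, hedges⟩ := hγ.exists_isPath_append x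
    rw [X.isPath_unique hp hqr, SimpleGraph.Walk.edges_append, List.pairwise_append] at hpw
    cases q with
    | nil => exact hx hm
    | cons hadj q =>
      refine hpw.2.2 _ List.mem_cons_self _ ?_ γ rfl
      rw [SimpleGraph.Walk.edges_reverse, List.mem_reverse, hedges]
      exact List.mem_map_of_mem List.mem_cons_self
  · obtain ⟨m, q, r, hm, hqr, -, hedges⟩ := hγ.exists_isPath_append (d0 e)
    obtain rfl : p = _ := X.isPath_unique hp hqr
    have hmem : esym (edgeSmul γ e) ∈ r.edges ↔ esym e ∈ q.edges := by
      rw [hedges]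
      exact List.mem_map_of_injective (Sym2.map.injective (X.smul_injective γ)) (a := esym e)
    have hedge (a) : a ∈ (q.append r.reverse).edges ↔ a ∈ q.edges ∨ a ∈ r.edges := by
      simp [SimpleGraph.Walk.edges_append]
    replace hxor : Xor (esym e ∈ (q.append r.reverse).edges)
        (esym (edgeSmul γ e) ∈ (q.append r.reverse).edges) := hxor
    rw [hedge, hedge] at hxor
    have hrev := hqr.reverse
    rw [SimpleGraph.Walk.reverse_append, SimpleGraph.Walk.reverse_reverse] at hrev
    by_cases hne : d0 e = m
    · subst hne
      obtain rfl := SimpleGraph.Walk.eq_nil_iff_nil.mpr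
        (SimpleGraph.Walk.isPath_iff_nil.mp hqr.of_append_left)
      rw [hedges] at hxor
      simp at hxor
    have hne' : X.smul γ (d0 e) ≠ m := fun h => hne (X.smul_injective γ (h.trans hm.symm))
    have hleft : esym e ∈ (q.append r.reverse).edges → esym e ∈ q.edges :=
      hqr.mem_edges_left_of_append hne
    have hright : esym (edgeSmul γ e) ∈ (r.append q.reverse).edges →
        esym (edgeSmul γ e) ∈ r.edges := hrev.mem_edges_left_of_append hne'
    rw [SimpleGraph.Walk.edges_append, SimpleGraph.Walk.edges_reverse, List.mem_append,
      List.mem_reverse] at hright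
    rw [hedge] at hleft
    unfold Xor at hxor
    tauto
end

section
/- Let X be a parabolic G-tree, i.e., some element of G is hyperbolic and G fixes an end ε of X. Then the set of elliptic elements of G is a subgroup of G. -/
universe u

namespace SimpleGraph

theorem exists_isPath_of_adj_succ {V : Type*} {Γ : SimpleGraph V} {r : ℕ → V}
    (hadj : ∀ n, Γ.Adj (r n) (r (n + 1))) (hinj : Function.Injective r) (m n : ℕ) :
    ∃ p : Γ.Walk (r m) (r (m + n)),
      p.IsPath ∧ p.length = n ∧ ∀ v ∈ p.support, ∃ i ≤ n, v = r (m + i) := by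
  induction n with
  | zero => exact ⟨Walk.nil, by simp, rfl, fun v hv => ⟨0, le_rfl, by simpa using hv⟩⟩
  | succ n ih =>
    obtain ⟨p, hp, hl, hs⟩ := ih
    refine ⟨p.concat (hadj (m + n)), hp.concat (fun h => ?_) _, by simp [hl], fun v hv => ?_⟩
    · obtain ⟨i, hi, h⟩ := hs _ h
      have := hinj h
      omega
    · rw [Walk.support_concat, List.mem_append, List.mem_singleton] at hv
      rcases hv with hv | rfl
      · obtain ⟨i, hi, h⟩ := hs _ hv
        exact ⟨i, hi.trans n.le_succ, h⟩
      · exact ⟨n + 1, le_rfl, rfl⟩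

theorem IsTree.dist_eq_of_adj_succ {V : Type*} {Γ : SimpleGraph V} (hΓ : Γ.IsTree) {r : ℕ → V}
    (hadj : ∀ n, Γ.Adj (r n) (r (n + 1))) (hinj : Function.Injective r) (m n : ℕ) :
    Γ.dist (r m) (r (m + n)) = n := by
  obtain ⟨p, hp, hl, -⟩ := exists_isPath_of_adj_succ hadj hinj m n
  obtain ⟨q, hq, hd⟩ := hΓ.connected.exists_path_of_dist (r m) (r (m + n))
  rw [← hd, (hΓ.existsUnique_path _ _).unique hq hp, hl]

/-- The distance from a vertex to a ray is not eventually periodic along the ray. -/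
theorem IsTree.eq_zero_of_dist_periodic {V : Type*} {Γ : SimpleGraph V} (hΓ : Γ.IsTree)
    {r : ℕ → V} (hadj : ∀ n, Γ.Adj (r n) (r (n + 1))) (hinj : Function.Injective r) (x : V)
    (m d : ℕ) (h : ∀ n, Γ.dist x (r (m + n + d)) = Γ.dist x (r (m + n))) : d = 0 := by
  by_contra hd
  have key : ∀ i : ℕ, Γ.dist x (r (m + i * d)) = Γ.dist x (r m) := by
    intro i
    induction i with
    | zero => simp
    | succ i ih => rw [← ih, ← h (i * d), add_mul, one_mul, add_assoc]
  have h1 := key (2 * Γ.dist x (r m) + 1)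
  have h2 := hΓ.dist_eq_of_adj_succ hadj hinj m ((2 * Γ.dist x (r m) + 1) * d)
  have h3 := hΓ.connected.dist_triangle (u := r m) (v := x)
    (w := r (m + (2 * Γ.dist x (r m) + 1) * d))
  rw [Γ.dist_comm (u := r m) (v := x)] at h3
  have h4 := Nat.le_mul_of_pos_right (2 * Γ.dist x (r m) + 1) (Nat.pos_of_ne_zero hd)
  omega

end SimpleGraph

namespace GTree

variable {G : Type u} [Group G]

theorem dist_smul_le (X : GTree G) (γ : G) (x y : X.V) :
    X.graph.dist (X.smul γ x) (X.smul γ y) ≤ X.graph.dist x y := by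
  obtain ⟨p, hp⟩ := X.isTree.connected.exists_walk_length_eq_dist x y
  let f : X.graph →g X.graph := ⟨X.smul γ, fun h => X.smul_adj γ h⟩
  rw [← hp, ← SimpleGraph.Walk.length_map f p]
  exact SimpleGraph.dist_le (p.map f)

theorem dist_smul (X : GTree G) (γ : G) (x y : X.V) :
    X.graph.dist (X.smul γ x) (X.smul γ y) = X.graph.dist x y := by
  refine le_antisymm (X.dist_smul_le γ x y) ?_
  simpa [← X.smul_mul, X.smul_one] using X.dist_smul_le γ⁻¹ (X.smul γ x) (X.smul γ y)

/-- An elliptic element fixing the end of a ray fixes a terminal segment of the ray. -/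
theorem Elliptic.eventually_mem_stab {X : GTree G} {γ : G} (hγ : X.Elliptic γ) {r : ℕ → X.V}
    (hadj : ∀ n, X.graph.Adj (r n) (r (n + 1))) (hinj : Function.Injective r)
    (hfix : ∃ m k : ℕ, ∀ n, X.smul γ (r (m + n)) = r (k + n)) :
    ∃ m, ∀ n, m ≤ n → γ ∈ X.stab (r n) := by
  obtain ⟨x, hx⟩ := hγ
  obtain ⟨m, k, h⟩ := hfix
  have hdist : ∀ n, X.graph.dist x (r (k + n)) = X.graph.dist x (r (m + n)) := fun n => by
    rw [← X.dist_smul γ x (r (m + n)), hx, h]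
  have hmk : m = k := by
    rcases le_total m k with hle | hle <;> obtain ⟨d, rfl⟩ := Nat.exists_eq_add_of_le hle
    · have := X.isTree.eq_zero_of_dist_periodic hadj hinj x m d
        fun n => by rw [add_right_comm, hdist]
      omega
    · have := X.isTree.eq_zero_of_dist_periodic hadj hinj x k d
        fun n => by rw [add_right_comm, hdist]
      omega
  subst hmk
  refine ⟨m, fun n hn => ?_⟩
  obtain ⟨i, rfl⟩ := Nat.exists_eq_add_of_le hn
  exact h i

end GTree

open GTree in
/-- Remark 2.5: in a parabolic `G`-tree (there is a fixed end, given here by a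
ray `r` all of whose `G`-translates eventually coincide with it, and some
element of `G` is hyperbolic), the set of elliptic elements of `G` is a
subgroup of `G`. -/
theorem parabolic_elliptic_subgroup {G : Type u} [Group G] (X : GTree G)
    (r : ℕ → X.V)
    (hadj : ∀ n, X.graph.Adj (r n) (r (n + 1)))
    (hinj : Function.Injective r)
    (hfix : ∀ γ : G, ∃ m k : ℕ, ∀ n, X.smul γ (r (m + n)) = r (k + n))
    (hhyp : ∃ γ : G, ¬ X.Elliptic γ) :
    ∃ H : Subgroup G, (H : Set G) = { γ | X.Elliptic γ } := by
  refine ⟨⟨⟨⟨{ γ | X.Elliptic γ }, ?_⟩, ⟨r 0, X.smul_one _⟩⟩, ?_⟩, rfl⟩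
  · intro a b ha hb
    obtain ⟨m, hm⟩ := Elliptic.eventually_mem_stab ha hadj hinj (hfix a)
    obtain ⟨k, hk⟩ := Elliptic.eventually_mem_stab hb hadj hinj (hfix b)
    exact ⟨r (max m k), (X.stab _).mul_mem (hm _ (le_max_left m k)) (hk _ (le_max_right m k))⟩
  · rintro a ⟨x, hx⟩
    exact ⟨x, (X.stab x).inv_mem hx⟩
end
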